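/- (Theorem 1) A(h) = h + O(h³) as h → 0, and the constant in the O-term is at most 16; precisely, for all sufficiently small h > 0 one has h ≤ A(h) ≤ h + 16h³. -/

import Mathlib

open Real

/-- Membership in the Turán class `K(h)`, encoded via the nonnegative Fourier cosine
coefficient sequence `a` of a continuous 1-periodic even function
`f(x) = ∑' n, a n * cos (2πnx)`: all `a n ≥ 0`, `∑ a n = 1` (so `f 0 = 1`), and
`f x = 0` for `h ≤ |x| ≤ 1/2`. -/
def memK (h : ℝ) (a : ℕ → ℝ) : Prop :=
  (∀ n, 0 ≤ a n) ∧ Summable a ∧ (∑' n, a n) = 1 ∧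
    ∀ x : ℝ, h ≤ |x| → |x| ≤ 1 / 2 → (∑' n : ℕ, a n * Real.cos (2 * π * n * x)) = 0

/-- The Turán constant `A(h) = sup_{f ∈ K(h)} a₀`. -/
noncomputable def turanA (h : ℝ) : ℝ :=
  sSup {y : ℝ | ∃ a : ℕ → ℝ, memK h a ∧ y = a 0}

/-- The Fourier cosine coefficients of the triangle function `x ↦ max (1 - |x| / h) 0`,
extended from `[-1/2, 1/2]` by periodicity. -/
noncomputable def triangleCoeff (h : ℝ) (n : ℕ) : ℝ :=
  if n = 0 then h else 2 * Real.sin (π * n * h) ^ 2 / (π ^ 2 * n ^ 2 * h)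

lemma triangleCoeff_nonneg {h : ℝ} (hh : 0 < h) (n : ℕ) : 0 ≤ triangleCoeff h n := by
  unfold triangleCoeff
  split_ifs <;> positivity

lemma hasSum_cos_div_sq {x : ℝ} (hx : x ∈ Set.Icc (0 : ℝ) 1) :
    HasSum (fun n : ℕ => 1 / (n : ℝ) ^ 2 * Real.cos (2 * π * n * x))
      (π ^ 2 * (x ^ 2 - x + 1 / 6)) := by
  have h := hasSum_one_div_nat_pow_mul_cos one_ne_zero hx
  have hB : Polynomial.bernoulli 2 =
      Polynomial.X ^ 2 - Polynomial.X + Polynomial.C (1 / 6 : ℚ) := by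
    have hC : Polynomial.C (-1 / 2 : ℚ) * 2 = -1 := by
      rw [← map_ofNat Polynomial.C 2, ← Polynomial.C_mul]
      norm_num
    rw [Polynomial.bernoulli_def]
    simp [Finset.sum_range_succ, bernoulli_two, bernoulli_one, ← Polynomial.C_mul_X_pow_eq_monomial]
    linear_combination Polynomial.X * hC
  rw [mul_one, hB] at h
  convert! h using 1
  simp [Nat.factorial]
  left
  ring

lemma hasSum_triangleCoeff_mul_cos_of_nonneg {h x : ℝ} (hh : 0 < h) (hh' : h ≤ 1 / 2)
    (hx : 0 ≤ x) (hx' : x ≤ 1 / 2) :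
    HasSum (fun n : ℕ => triangleCoeff h n * Real.cos (2 * π * n * x)) ((max h x - x) / h) := by
  have h0 := hasSum_cos_div_sq (x := x) ⟨hx, by linarith⟩
  have h1 := hasSum_cos_div_sq (x := x + h) ⟨by linarith, by linarith⟩
  have h2 := hasSum_cos_div_sq (x := |x - h|)
    ⟨abs_nonneg _, abs_le.2 ⟨by linarith, by linarith⟩⟩
  have h3 := (((h0.mul_left (1 / (π ^ 2 * h))).sub (h1.mul_left (1 / (2 * π ^ 2 * h)))).sub
    (h2.mul_left (1 / (2 * π ^ 2 * h)))).add (hasSum_ite_eq (0 : ℕ) h)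
  convert! h3 using 1
  · funext n
    by_cases hn : n = 0
    · simp [hn, triangleCoeff]
    have hn' : (n : ℝ) ≠ 0 := Nat.cast_ne_zero.2 hn
    have habs : Real.cos (2 * π * n * |x - h|) = Real.cos (2 * π * n * x - 2 * (π * n * h)) := by
      rcases abs_choice (x - h) with hc | hc <;> rw [hc]
      · congr 1; ring
      · rw [← Real.cos_neg]; congr 1; ring
    have hadd : 2 * π * n * (x + h) = 2 * π * n * x + 2 * (π * n * h) := by ring
    simp only [triangleCoeff, hn, if_false]
    rw [habs, hadd, Real.cos_add, Real.cos_sub, Real.cos_two_mul, Real.cos_sq']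
    have := Real.pi_ne_zero
    field_simp
    ring
  · have hπ := Real.pi_ne_zero
    rcases le_total x h with hc | hc
    · rw [max_eq_left hc, abs_of_nonpos (by linarith)]
      field_simp
      ring
    · rw [max_eq_right hc, abs_of_nonneg (by linarith)]
      field_simp
      ring

lemma cos_two_pi_mul_abs (n : ℕ) (x : ℝ) :
    Real.cos (2 * π * n * |x|) = Real.cos (2 * π * n * x) := by
  rcases abs_choice x with hc | hc <;> rw [hc]
  rw [← Real.cos_neg]
  congr 1
  ring

lemma cos_two_pi_mul_sub_int (n : ℕ) (x : ℝ) (j : ℤ) :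
    Real.cos (2 * π * n * (x - j)) = Real.cos (2 * π * n * x) := by
  rw [← Real.cos_sub_int_mul_two_pi (2 * π * n * x) (n * j)]
  congr 1
  push_cast
  ring

lemma hasSum_triangleCoeff_mul_cos {h x : ℝ} (hh : 0 < h) (hh' : h ≤ 1 / 2)
    (hx : |x| ≤ 1 / 2) :
    HasSum (fun n : ℕ => triangleCoeff h n * Real.cos (2 * π * n * x))
      ((max h |x| - |x|) / h) := by
  simpa only [cos_two_pi_mul_abs] using
    hasSum_triangleCoeff_mul_cos_of_nonneg hh hh' (abs_nonneg x) hx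

lemma hasSum_triangleCoeff {h : ℝ} (hh : 0 < h) (hh' : h ≤ 1 / 2) :
    HasSum (triangleCoeff h) 1 := by
  simpa [hh.le, hh.ne'] using hasSum_triangleCoeff_mul_cos hh hh' (x := 0) (by norm_num)

lemma tsum_triangleCoeff_mul_cos_nonneg {h : ℝ} (hh : 0 < h) (hh' : h ≤ 1 / 2) (x : ℝ) :
    0 ≤ ∑' n : ℕ, triangleCoeff h n * Real.cos (2 * π * n * x) := by
  have hs := hasSum_triangleCoeff_mul_cos hh hh' (abs_sub_round x)
  simp only [cos_two_pi_mul_sub_int] at hs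
  rw [hs.tsum_eq]
  exact div_nonneg (sub_nonneg.2 (le_max_right _ _)) hh.le

lemma memK_triangleCoeff {h : ℝ} (hh : 0 < h) (hh' : h ≤ 1 / 2) : memK h (triangleCoeff h) := by
  refine ⟨triangleCoeff_nonneg hh, (hasSum_triangleCoeff hh hh').summable,
    (hasSum_triangleCoeff hh hh').tsum_eq, fun x hx hx' => ?_⟩
  rw [(hasSum_triangleCoeff_mul_cos hh hh' hx').tsum_eq, max_eq_right hx]
  simp

lemma triangleCoeff_le {h : ℝ} (hh : 0 < h) {n : ℕ} (hn : n ≠ 0)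
    (hd : |n * h - round (n * h)| < h) : triangleCoeff h n ≤ 2 * h / n ^ 2 := by
  have hn' : (0 : ℝ) < n := by positivity
  have hs : Real.sin (π * n * h) ^ 2 ≤ (π * h) ^ 2 := by
    have h1 : |Real.sin (π * n * h)| = |Real.sin (π * (n * h - round (n * h)))| := by
      have h2 : π * (n * h - round (n * h)) = π * n * h - (round (n * h) : ℤ) * π := by ring
      rw [h2, Real.sin_sub_int_mul_pi]
      simp [abs_mul]
    rw [← sq_abs, h1]
    refine pow_le_pow_left₀ (abs_nonneg _) (Real.abs_sin_le_abs.trans ?_) 2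
    rw [abs_mul, abs_of_pos Real.pi_pos]
    gcongr
  rw [triangleCoeff, if_neg hn, div_le_div_iff₀ (by positivity) (by positivity)]
  have : (0 : ℝ) ≤ 2 * n ^ 2 := by positivity
  nlinarith [mul_le_mul_of_nonneg_left hs this]

/-- A nonnegative sequence supported on the integers within distance `1` of the positive multiples
of `1 / h` and bounded there by `2 h / k ^ 2` has sum at most `16 h ^ 3`. -/
lemma tsum_le_of_support_near_multiples {h : ℝ} (hh : 0 < h) (hh' : h ≤ 1 / 4) {g : ℕ → ℝ}
    (hg : ∀ k, 0 ≤ g k) (hgs : Summable g) (hg' : ∀ k, k ≠ 0 → g k ≤ 2 * h / k ^ 2)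
    (hsupp : ∀ k, g k ≠ 0 → ∃ j : ℕ, |k * h - (j + 1 : ℕ)| < h) :
    ∑' k, g k ≤ 16 * h ^ 3 := by
  let e (i j : ℕ) : ℕ := ⌊((j + 1 : ℕ) : ℝ) / h⌋₊ + i
  have he_inj (i : ℕ) : Function.Injective (e i) := by
    refine StrictMono.injective (strictMono_nat_of_lt_succ fun j => ?_)
    have h1 : ((j + 1 : ℕ) : ℝ) / h + 1 ≤ ((j + 1 + 1 : ℕ) : ℝ) / h := by
      rw [div_add_one hh.ne', div_le_div_iff_of_pos_right hh]
      push_cast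
      linarith
    have h2 := Nat.floor_le_floor h1
    rw [Nat.floor_add_one (by positivity)] at h2
    simp only [e]
    omega
  have hcover (k : ℕ) (hk : g k ≠ 0) : k ∈ Set.range (e 0) ∪ Set.range (e 1) := by
    obtain ⟨j, hj⟩ := hsupp k hk
    rw [abs_lt] at hj
    have h1 : ((j + 1 : ℕ) : ℝ) / h < k + 1 := by rw [div_lt_iff₀ hh]; linarith
    have h2 : (k : ℝ) - 1 < ((j + 1 : ℕ) : ℝ) / h := by rw [lt_div_iff₀ hh]; linarith
    have h3 : ⌊((j + 1 : ℕ) : ℝ) / h⌋₊ < k + 1 :=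
      (Nat.floor_lt (by positivity)).2 (by exact_mod_cast h1)
    have h4 : k < ⌊((j + 1 : ℕ) : ℝ) / h⌋₊ + 2 := by
      have := Nat.lt_floor_add_one (((j + 1 : ℕ) : ℝ) / h)
      have h5 : (k : ℝ) < ⌊((j + 1 : ℕ) : ℝ) / h⌋₊ + 2 := by linarith
      exact_mod_cast h5
    by_cases hk' : k = ⌊((j + 1 : ℕ) : ℝ) / h⌋₊
    · exact Or.inl ⟨j, by simp [e, hk']⟩
    · exact Or.inr ⟨j, by simp only [e]; omega⟩
  have hbound (i j : ℕ) : g (e i j) ≤ 32 / 9 * h ^ 3 * (1 / ((j + 1 : ℕ) : ℝ) ^ 2) := by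
    have hj : (0 : ℝ) < (j + 1 : ℕ) := by positivity
    have hj1 : (1 : ℝ) ≤ (j + 1 : ℕ) := by exact_mod_cast Nat.le_add_left 1 j
    have h1 : 3 / 4 * ((j + 1 : ℕ) : ℝ) / h ≤ e i j := by
      have h2 := (Nat.lt_floor_add_one (((j + 1 : ℕ) : ℝ) / h)).le
      have h3 : 3 / 4 * ((j + 1 : ℕ) : ℝ) / h ≤ ((j + 1 : ℕ) : ℝ) / h - 1 := by
        rw [div_sub_one hh.ne', div_le_div_iff_of_pos_right hh]
        linarith
      have h4 : (0 : ℝ) ≤ i := Nat.cast_nonneg i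
      simp only [e]
      push_cast at h2 h3 ⊢
      linarith
    have h5 : (0 : ℝ) < e i j := lt_of_lt_of_le (by positivity) h1
    calc g (e i j) ≤ 2 * h / (e i j : ℝ) ^ 2 := hg' _ (by exact_mod_cast h5.ne')
      _ ≤ 2 * h / (3 / 4 * ((j + 1 : ℕ) : ℝ) / h) ^ 2 := by gcongr
      _ = 32 / 9 * h ^ 3 * (1 / ((j + 1 : ℕ) : ℝ) ^ 2) := by field_simp; norm_num
  have hzeta : HasSum (fun j : ℕ => 1 / ((j + 1 : ℕ) : ℝ) ^ 2) (π ^ 2 / 6) := by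
    simpa using (hasSum_nat_add_iff' 1).2 hasSum_zeta_two
  have hpart (i : ℕ) : ∑' k, (Set.range (e i)).indicator g k ≤ 8 * h ^ 3 := by
    rw [← (he_inj i).tsum_eq Set.support_indicator_subset]
    have h1 : ∑' j, (Set.range (e i)).indicator g (e i j)
        ≤ ∑' j : ℕ, 32 / 9 * h ^ 3 * (1 / ((j + 1 : ℕ) : ℝ) ^ 2) := by
      refine Summable.tsum_le_tsum (fun j => ?_)
        ((hgs.indicator _).comp_injective (he_inj i)) (hzeta.summable.mul_left _)
      rw [Set.indicator_of_mem (Set.mem_range_self j)]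
      exact hbound i j
    rw [(hzeta.mul_left _).tsum_eq] at h1
    have h2 : π ^ 2 / 6 ≤ 9 / 4 := by nlinarith [Real.pi_lt_d2, Real.pi_pos]
    nlinarith [mul_le_mul_of_nonneg_left h2 (by positivity : 0 ≤ 32 / 9 * h ^ 3)]
  calc ∑' k, g k
      ≤ ∑' k, ((Set.range (e 0)).indicator g k + (Set.range (e 1)).indicator g k) := by
        refine Summable.tsum_le_tsum (fun k => ?_) hgs ((hgs.indicator _).add (hgs.indicator _))
        have h0 := Set.indicator_nonneg (s := Set.range (e 0)) (fun k _ => hg k) k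
        have h1 := Set.indicator_nonneg (s := Set.range (e 1)) (fun k _ => hg k) k
        by_cases hk : g k = 0
        · rw [hk]; positivity
        · rcases hcover k hk with hm | hm
          · rw [Set.indicator_of_mem hm]; linarith
          · rw [Set.indicator_of_mem hm]; linarith
    _ = _ := (hgs.indicator _).tsum_add (hgs.indicator _)
    _ ≤ 16 * h ^ 3 := by linarith [hpart 0, hpart 1]

namespace memK

variable {h : ℝ} {a : ℕ → ℝ}

lemma abs_tsum_le_one (ha : memK h a) (x : ℝ) :
    |∑' n : ℕ, a n * Real.cos (2 * π * n * x)| ≤ 1 := by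
  rw [← ha.2.2.1, ← Real.norm_eq_abs]
  refine tsum_of_norm_bounded ha.2.1.hasSum fun n => ?_
  rw [norm_mul, Real.norm_of_nonneg (ha.1 n)]
  exact mul_le_of_le_one_right (ha.1 n) (Real.abs_cos_le_one _)

lemma abs_sub_round_lt (ha : memK h a) {x : ℝ}
    (hx : ∑' n : ℕ, a n * Real.cos (2 * π * n * x) ≠ 0) : |x - round x| < h := by
  by_contra! hc
  apply hx
  simpa only [cos_two_pi_mul_sub_int] using ha.2.2.2 (x - round x) hc (abs_sub_round x)

/-- Testing `f` against the triangle coefficients along the progression `k h`. -/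
lemma coeff_zero_le_tsum (ha : memK h a) (hh : 0 < h) (hh' : h ≤ 1 / 2) :
    a 0 ≤ ∑' k : ℕ, triangleCoeff h k * ∑' n : ℕ, a n * Real.cos (2 * π * n * (k * h)) := by
  have hb := hasSum_triangleCoeff hh hh'
  have hprod : Summable fun p : ℕ × ℕ =>
      triangleCoeff h p.1 * (a p.2 * Real.cos (2 * π * p.2 * (p.1 * h))) := by
    refine Summable.of_norm_bounded (hb.summable.mul_of_nonneg ha.2.1
      (triangleCoeff_nonneg hh) ha.1) fun p => ?_
    rw [norm_mul, norm_mul, Real.norm_of_nonneg (triangleCoeff_nonneg hh _),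
      Real.norm_of_nonneg (ha.1 _)]
    exact mul_le_mul_of_nonneg_left
      (mul_le_of_le_one_right (ha.1 _) (Real.abs_cos_le_one _)) (triangleCoeff_nonneg hh _)
  have hcol (n : ℕ) : ∑' k : ℕ, triangleCoeff h k * (a n * Real.cos (2 * π * n * (k * h)))
      = a n * ∑' k : ℕ, triangleCoeff h k * Real.cos (2 * π * k * (n * h)) := by
    rw [← tsum_mul_left]
    refine tsum_congr fun k => ?_
    rw [show 2 * π * n * (k * h) = 2 * π * k * (n * h) by ring]
    ring
  have hsum := hprod.prod_symm.prod
  simp only [← tsum_mul_left]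
  rw [Summable.tsum_comm (f := fun n k : ℕ =>
    triangleCoeff h k * (a n * Real.cos (2 * π * n * (k * h)))) hprod.prod_symm]
  simp only [Prod.swap_prod_mk, hcol] at hsum ⊢
  refine le_trans (le_of_eq ?_) (hsum.le_tsum 0 fun n _ =>
    mul_nonneg (ha.1 n) (tsum_triangleCoeff_mul_cos_nonneg hh hh' _))
  simp [hb.tsum_eq]

lemma coeff_zero_le (ha : memK h a) (hh : 0 < h) (hh' : h ≤ 1 / 4) :
    a 0 ≤ h + 16 * h ^ 3 := by
  set F : ℕ → ℝ := fun k => ∑' n : ℕ, a n * Real.cos (2 * π * n * (k * h))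
  have hb := (hasSum_triangleCoeff hh (by linarith)).summable
  have hF1 (k : ℕ) : |F k| ≤ 1 := ha.abs_tsum_le_one _
  let g : ℕ → ℝ := fun k => if k = 0 then 0 else triangleCoeff h k * |F k|
  have hg (k : ℕ) : 0 ≤ g k := by
    simp only [g]
    split_ifs
    · rfl
    · exact mul_nonneg (triangleCoeff_nonneg hh k) (abs_nonneg _)
  have hgb (k : ℕ) : g k ≤ triangleCoeff h k := by
    simp only [g]
    split_ifs
    · exact triangleCoeff_nonneg hh k
    · exact mul_le_of_le_one_right (triangleCoeff_nonneg hh k) (hF1 k)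
  have hgs : Summable g := hb.of_nonneg_of_le hg hgb
  have hnear (k : ℕ) (hk : g k ≠ 0) : k ≠ 0 ∧ |k * h - round (k * h)| < h := by
    simp only [g, ne_eq, ite_eq_left_iff, not_forall, mul_eq_zero, not_or, abs_eq_zero] at hk
    exact ⟨hk.1, ha.abs_sub_round_lt hk.2.2⟩
  have hg16 : ∑' k, g k ≤ 16 * h ^ 3 := by
    refine tsum_le_of_support_near_multiples hh hh' hg hgs (fun k hk0 => ?_) fun k hk => ?_
    · by_cases hk : g k = 0
      · rw [hk]; positivity
      · exact (hgb k).trans (triangleCoeff_le hh hk0 (hnear k hk).2)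
    · obtain ⟨hk0, hlt⟩ := hnear k hk
      have hk1 : (1 : ℝ) ≤ k := by exact_mod_cast Nat.one_le_iff_ne_zero.2 hk0
      have hpos : 0 < round (k * h) := by
        have h1 := (abs_lt.1 hlt).2
        have h2 : (0 : ℝ) < round (k * h) := by nlinarith
        exact_mod_cast h2
      obtain ⟨j, hj⟩ := Int.eq_succ_of_zero_lt hpos
      refine ⟨j, ?_⟩
      rw [hj] at hlt
      exact_mod_cast hlt
  have hle (k : ℕ) : triangleCoeff h k * F k ≤ (if k = 0 then h else 0) + g k := by
    by_cases hk : k = 0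
    · subst hk
      simpa [g, triangleCoeff] using
        mul_le_of_le_one_right hh.le ((le_abs_self _).trans (hF1 0))
    · simp only [g, hk, if_false, zero_add]
      exact mul_le_mul_of_nonneg_left (le_abs_self _) (triangleCoeff_nonneg hh k)
  have hsF : Summable fun k => triangleCoeff h k * F k := by
    refine Summable.of_norm_bounded hb fun k => ?_
    rw [norm_mul, Real.norm_of_nonneg (triangleCoeff_nonneg hh k)]
    exact mul_le_of_le_one_right (triangleCoeff_nonneg hh k) (hF1 k)
  have htot := hasSum_le hle hsF.hasSum ((hasSum_ite_eq (0 : ℕ) h).add hgs.hasSum)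
  linarith [ha.coeff_zero_le_tsum hh (by linarith)]

end memK

/-- `A(h) = h + O(h³)` as `h → 0`, with the constant in the `O` at most `16`:
for all sufficiently small `h > 0`, `h ≤ A(h) ≤ h + 16 h³`. -/
theorem turanA_asymptotic : ∃ h₀ : ℝ, 0 < h₀ ∧
    ∀ h : ℝ, 0 < h → h ≤ h₀ → h ≤ turanA h ∧ turanA h ≤ h + 16 * h ^ 3 := by
  refine ⟨1 / 4, by norm_num, fun h hh hh' => ?_⟩
  have hK := memK_triangleCoeff hh (by linarith)
  have hmem : h ∈ {y : ℝ | ∃ a : ℕ → ℝ, memK h a ∧ y = a 0} := ⟨_, hK, by simp [triangleCoeff]⟩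
  have hub : h + 16 * h ^ 3 ∈ upperBounds {y : ℝ | ∃ a : ℕ → ℝ, memK h a ∧ y = a 0} := by
    rintro _ ⟨a, ha, rfl⟩
    exact ha.coeff_zero_le hh hh'
  exact ⟨le_csSup ⟨_, hub⟩ hmem, csSup_le ⟨_, hmem⟩ hub⟩
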